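/- arXiv:1012.4927 — 2 statements merged into one kernel-verified Lean document; each statement's English description precedes it below -/
import Mathlib

section
/- Let z ∈ ℂ be such that M(z) has an everywhere defined bounded inverse M(z)^{-1} ∈ B(H). Then: (a) B M(z)^{-1} is everywhere defined on H and bounded; (b) the operator M(z)^{-1} B, defined on dom(B), is closable and its closure is bounded, with closure(M(z)^{-1} B) = (B (M(z)*)^{-1})*; and (c) the operator B M(z)^{-1} B, defined on dom(B), is closable with bounded closure. -/
open scoped InnerProductSpace

theorem aux_closed_comp {H : Type*}
    [NormedAddCommGroup H] [InnerProductSpace ℂ H] [CompleteSpace H]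
    (A : H →ₗ.[ℂ] H) (hA : A.IsClosable) (Q : H →L[ℂ] H) (hQ : ∀ v, Q v ∈ A.domain) :
    ∃ L : H →L[ℂ] H, ∀ v, (Q v, L v) ∈ A.graph := by
  let g : H →ₗ[ℂ] H := A.toFun.comp (Q.toLinearMap.codRestrict A.domain hQ)
  have hg : ∀ v, (Q v, g v) ∈ A.graph := fun v => A.mem_graph ⟨Q v, hQ v⟩
  obtain ⟨A', hA'⟩ := hA
  have hcl : IsClosed (A'.graph : Set (H × H)) := by
    rw [← hA']; exact A.graph.isClosed_topologicalClosure
  have hle : ∀ p, p ∈ A.graph → p ∈ A'.graph := by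
    intro p hp
    rw [← hA']; exact A.graph.le_topologicalClosure hp
  have hcont : Continuous g := by
    apply LinearMap.continuous_of_seq_closed_graph
    intro u x y hu hy
    have h1 : Filter.Tendsto (fun n => (Q (u n), g (u n))) Filter.atTop (nhds (Q x, y)) :=
      (((Q.continuous.tendsto x).comp hu)).prodMk_nhds hy
    have h2 : (Q x, y) ∈ A'.graph :=
      hcl.mem_of_tendsto h1 (Filter.Eventually.of_forall fun n => hle _ (hg (u n)))
    exact A'.mem_graph_snd_inj h2 (hle _ (hg x)) rfl
  exact ⟨⟨g, hcont⟩, hg⟩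

theorem aux_sa_resolvent {H : Type*}
    [NormedAddCommGroup H] [InnerProductSpace ℂ H] [CompleteSpace H]
    (B : H →ₗ.[ℂ] H) (hd : Dense (B.domain : Set H)) (hsa : B.adjoint = B) :
    ∃ G P : H →L[ℂ] H, ∀ v, (G v, P v) ∈ B.graph ∧ (P v, v - G v) ∈ B.graph := by
  have hcl : IsClosed (B.graph : Set (H × H)) := by
    have := B.adjoint_isClosed hd
    rw [hsa] at this; exact this
  have hgr : B.graph = B.graph.adjoint := by
    conv_lhs => rw [← hsa]
    exact LinearPMap.adjoint_graph_eq_graph_adjoint hd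
  let e := WithLp.prodContinuousLinearEquiv 2 ℂ H H
  let K : Submodule ℂ (WithLp 2 (H × H)) := B.graph.comap e.toLinearEquiv.toLinearMap
  have hK : IsClosed (K : Set (WithLp 2 (H × H))) := hcl.preimage e.continuous
  have : CompleteSpace K := hK.completeSpace_coe
  let p : H →L[ℂ] H × H := (e : WithLp 2 (H × H) →L[ℂ] H × H) ∘L K.starProjection ∘L
    (e.symm : H × H →L[ℂ] WithLp 2 (H × H)) ∘L ContinuousLinearMap.inl ℂ H H
  have hp : ∀ v, p v ∈ B.graph := fun v =>
    K.starProjection_apply_mem (e.symm (v, 0))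
  refine ⟨ContinuousLinearMap.fst ℂ H H ∘L p, ContinuousLinearMap.snd ℂ H H ∘L p, fun v => ⟨hp v, ?_⟩⟩
  rw [hgr, Submodule.mem_adjoint_iff]
  intro a b hab
  have h := K.starProjection_inner_eq_zero (e.symm (v, 0)) (e.symm (a, b)) hab
  have h' := congrArg (starRingEnd ℂ) h
  rw [inner_conj_symm, WithLp.prod_inner_apply] at h'
  have h2 : ⟪a, v - (p v).1⟫_ℂ + ⟪b, 0 - (p v).2⟫_ℂ = 0 := by
    rw [map_zero] at h'
    exact h'
  simp only [zero_sub, inner_neg_right] at h2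
  change ⟪b, (p v).2⟫_ℂ - ⟪a, v - (p v).1⟫_ℂ = 0
  linear_combination -h2

/-- Lemma 5.2 (iii). Let `B` be self-adjoint in `H` with `ker(B) = {0}` and
`R` densely defined closable with `dom(R) ∩ dom(R*) ⊇ dom(B)`; let
`M(z) = B² − izR − z²I` on `dom(B²)` and suppose `M(z)` has an everywhere defined bounded
inverse `M(z)⁻¹ ∈ B(H)`.  Then (a) `B M(z)⁻¹` is everywhere defined and bounded;
(b) `M(z)⁻¹ B` (on `dom(B)`) is closable with bounded closure
`closure(M(z)⁻¹B) = (B (M(z)*)⁻¹)*`; and (c) `B M(z)⁻¹ B` (on `dom(B)`) is closable with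
bounded closure. -/
theorem pencil_resolvent_smoothing
    {H : Type*}
    [NormedAddCommGroup H] [InnerProductSpace ℂ H] [CompleteSpace H]
    [TopologicalSpace.SeparableSpace H]
    (B : H →ₗ.[ℂ] H)
    (hBdense : Dense (B.domain : Set H))
    (hBsa : B.adjoint = B)
    (hBker : ∀ f : B.domain, B f = 0 → (f : H) = 0)
    (R : H →ₗ.[ℂ] H)
    (hRdense : Dense (R.domain : Set H))
    (hRclosable : R.IsClosable)
    (hRdom : B.domain ≤ R.domain)
    (hRstardom : B.domain ≤ R.adjoint.domain)
    -- `B² = B ∘ B` with its natural domain: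
    (B2 : H →ₗ.[ℂ] H)
    (hB2 : ∀ (x y : H), (x, y) ∈ B2.graph ↔
      ∃ (hx : x ∈ B.domain) (hBx : B ⟨x, hx⟩ ∈ B.domain), B ⟨B ⟨x, hx⟩, hBx⟩ = y)
    -- the pencil `M(z) = B² − i z R − z² I` with `dom(M(z)) = dom(B²)`:
    (M : ℂ → (H →ₗ.[ℂ] H))
    (hMdom : ∀ z : ℂ, (M z).domain = B2.domain)
    (hMval : ∀ (z : ℂ) (x : (M z).domain) (hx2 : (x : H) ∈ B2.domain)
      (hxR : (x : H) ∈ R.domain),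
      M z x = B2 ⟨(x : H), hx2⟩ - (Complex.I * z) • R ⟨(x : H), hxR⟩ - z ^ 2 • (x : H))
    -- `z ∈ ρ(M(·))` with bounded inverse `Minv = M(z)⁻¹`:
    (z : ℂ) (Minv : H →L[ℂ] H)
    (hMinv : ∀ w : H, (Minv w, w) ∈ (M z).graph)
    (hMinv' : ∀ x y : H, (x, y) ∈ (M z).graph → Minv y = x) :
    -- (a) `B M(z)⁻¹ ∈ B(H)`:
    (∃ S : H →L[ℂ] H, ∀ u : H, (Minv u, S u) ∈ B.graph) ∧
    -- (b) `(M(z)*)⁻¹` exists in `B(H)`, and `closure(M(z)⁻¹ B) = (B (M(z)*)⁻¹)* ∈ B(H)`: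
    (∃ T BT : H →L[ℂ] H,
      (∀ w : H, (T w, w) ∈ (M z).adjoint.graph) ∧
      (∀ x y : H, (x, y) ∈ (M z).adjoint.graph → T y = x) ∧
      (∀ u : H, (T u, BT u) ∈ B.graph) ∧
      (∀ (f : H) (hf : f ∈ B.domain),
        ContinuousLinearMap.adjoint BT f = Minv (B ⟨f, hf⟩))) ∧
    -- (c) `B M(z)⁻¹ B` (defined on `dom(B)`) has a bounded everywhere defined closure:
    (∃ S'' : H →L[ℂ] H, ∀ (f : H) (hf : f ∈ B.domain),
      (Minv (B ⟨f, hf⟩), S'' f) ∈ B.graph) := by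
  obtain ⟨G, P, hGP⟩ := aux_sa_resolvent B hBdense hBsa
  have hBcl : B.IsClosable := by
    have := B.adjoint_isClosed hBdense
    rw [hBsa] at this; exact this.isClosable
  have hgr : B.graph = B.graph.adjoint := by
    conv_lhs => rw [← hBsa]
    exact LinearPMap.adjoint_graph_eq_graph_adjoint hBdense
  have dom : ∀ {A : H →ₗ.[ℂ] H} {x y : H}, (x, y) ∈ A.graph → x ∈ A.domain :=
    fun h => LinearPMap.mem_domain_of_mem_graph h
  -- description of the graph of `B2` and `M z`
  have hB2' : ∀ x y w, (x, y) ∈ B.graph → (y, w) ∈ B.graph → (x, w) ∈ B2.graph := by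
    intro x y w hxy hyw
    have hx := dom hxy
    have e1 : y = B ⟨x, hx⟩ := (LinearPMap.image_iff hx).2 hxy
    subst e1
    exact (hB2 _ _).2 ⟨dom hxy, dom hyw, ((LinearPMap.image_iff (dom hyw)).2 hyw).symm⟩
  have hB2dom : ∀ x, x ∈ B2.domain → x ∈ B.domain := by
    intro x hx
    obtain ⟨h, -⟩ := (hB2 x _).1 (B2.mem_graph ⟨x, hx⟩)
    exact h
  have hMg : ∀ x y w r, (x, y) ∈ B.graph → (y, w) ∈ B.graph → (x, r) ∈ R.graph →
      (x, w - (Complex.I * z) • r - z ^ 2 • x) ∈ (M z).graph := by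
    intro x y w r hxy hyw hr
    have h2 := hB2' x y w hxy hyw
    have hxM : x ∈ (M z).domain := by rw [hMdom]; exact dom h2
    have := hMval z ⟨x, hxM⟩ (dom h2) (dom hr)
    rw [← (LinearPMap.image_iff (dom h2)).2 h2, ← (LinearPMap.image_iff (dom hr)).2 hr] at this
    rw [← this]
    exact (M z).mem_graph ⟨x, hxM⟩
  have hMinvB : ∀ w, Minv w ∈ B.domain := by
    intro w
    apply hB2dom
    rw [← hMdom z]
    exact dom (hMinv w)
  obtain ⟨S, hS⟩ := aux_closed_comp B hBcl Minv hMinvB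
  obtain ⟨L, hL⟩ := aux_closed_comp R hRclosable P (fun v => hRdom (dom (hGP v).2))
  let K : H →L[ℂ] H := (Complex.I * z) • L + (1 + z ^ 2) • P
  let S2 : H →L[ℂ] H := P + Minv ∘L K
  have hS2 : ∀ (f : H) (hf : f ∈ B.domain), Minv (B ⟨f, hf⟩) = S2 f := by
    intro f hf
    have h1 : (f - G f, B ⟨f, hf⟩ - P f) ∈ B.graph :=
      B.graph.sub_mem (B.mem_graph ⟨f, hf⟩) (hGP f).1
    have h2 := hMinv' _ _ (hMg _ _ _ _ (hGP f).2 h1 (hL f))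
    have h3 : B ⟨f, hf⟩ = (B ⟨f, hf⟩ - P f - (Complex.I * z) • L f - z ^ 2 • P f) + K f := by
      simp only [K, add_apply, smul_apply]
      module
    rw [h3, map_add, h2]
    rfl
  have hMdense : Dense ((M z).domain : Set H) := by
    rw [Submodule.dense_iff_topologicalClosure_eq_top, Submodule.topologicalClosure_eq_top_iff,
      Submodule.eq_bot_iff]
    intro w hw
    have hGw : G w ∈ (M z).domain := by
      rw [hMdom]; exact dom (hB2' _ _ _ (hGP w).1 (hGP w).2)
    have h0 : ⟪G w, w⟫_ℂ = 0 := (Submodule.mem_orthogonal _ _).1 hw _ hGw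
    have h1 : (P w, w - G w) ∈ B.graph.adjoint := hgr ▸ (hGP w).2
    have h2 := (Submodule.mem_adjoint_iff _ _).1 h1 _ _ (hGP w).1
    simp only [inner_sub_right, h0, zero_sub, sub_neg_eq_add] at h2
    have h3 := congrArg Complex.re h2
    have e1 : (⟪P w, P w⟫_ℂ).re = ‖P w‖ ^ 2 := by
      simp [inner_self_eq_norm_sq_to_K, ← Complex.ofReal_pow]
    have e2 : (⟪G w, G w⟫_ℂ).re = ‖G w‖ ^ 2 := by
      simp [inner_self_eq_norm_sq_to_K, ← Complex.ofReal_pow]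
    rw [Complex.add_re, e1, e2, Complex.zero_re] at h3
    have hG0 : G w = 0 := by
      rw [← norm_eq_zero]; nlinarith [sq_nonneg ‖P w‖, sq_nonneg ‖G w‖, norm_nonneg (G w)]
    have hP0 : P w = 0 := by
      rw [← norm_eq_zero]; nlinarith [sq_nonneg ‖P w‖, sq_nonneg ‖G w‖, norm_nonneg (P w)]
    have h4 := (hGP w).2
    rw [hP0, hG0, sub_zero] at h4
    exact B.graph_fst_eq_zero_snd h4 rfl
  have hMadj : (M z).adjoint.graph = (M z).graph.adjoint :=
    LinearPMap.adjoint_graph_eq_graph_adjoint hMdense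
  refine ⟨⟨S, hS⟩, ⟨ContinuousLinearMap.adjoint Minv, ContinuousLinearMap.adjoint S2,
    ?_, ?_, ?_, ?_⟩, ?_⟩
  · intro w
    rw [hMadj, Submodule.mem_adjoint_iff]
    intro a b hab
    simp only [ContinuousLinearMap.adjoint_inner_right, hMinv' a b hab, sub_self]
  · intro x y hxy
    rw [hMadj, Submodule.mem_adjoint_iff] at hxy
    refine ext_inner_left ℂ fun v => ?_
    rw [ContinuousLinearMap.adjoint_inner_right]
    exact (sub_eq_zero.1 (hxy _ _ (hMinv v))).symm
  · intro u
    rw [hgr, Submodule.mem_adjoint_iff]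
    intro a b hab
    have ha := dom hab
    simp only [ContinuousLinearMap.adjoint_inner_right]
    rw [(LinearPMap.image_iff ha).2 hab, hS2 a ha, sub_self]
  · intro f hf
    rw [ContinuousLinearMap.adjoint_adjoint, hS2]
  · refine ⟨ContinuousLinearMap.id ℂ H - G + S ∘L K, fun f hf => ?_⟩
    rw [hS2 f hf]
    exact B.graph.add_mem (hGP f).2 (hS (K f))
end

section
/- Let u : [0,∞) → H be twice continuously differentiable with u(t) ∈ dom(L²), L²u(t) ∈ dom(B), Lu(t) ∈ dom(B), u̇(t) ∈ dom(R) ∩ dom(B), and Ru̇(t) ∈ dom(B) for all t ≥ 0, satisfying the damped abstract wave equation ü(t) + Ru̇(t) + L²u(t) = 0 for t ≥ 0; assume moreover that t ↦ B L u(t) and t ↦ B u̇(t) are continuously differentiable on [0,∞). Then for all t ≥ 0, d/dt [‖B u̇(t)‖² + ‖L B u(t)‖²] = −2 Re⟨B u̇(t), B R u̇(t)⟩. In particular, if R = 0 then ‖B u̇(t)‖² + ‖L B u(t)‖² is constant in t. -/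
open scoped InnerProductSpace

theorem aux_deriv_mem {E : Type*} [NormedAddCommGroup E] [NormedSpace ℝ E] (G : Submodule ℝ E)
    (hG : IsClosed (G : Set E)) (F : ℝ → E) (F' : E) (t : ℝ) (ht : t ∈ Set.Ici (0 : ℝ))
    (hF : ∀ s ∈ Set.Ici (0 : ℝ), F s ∈ G) (h : HasDerivWithinAt F F' (Set.Ici 0) t) :
    F' ∈ G := by
  have h2 : HasDerivWithinAt F F' (Set.Ioi t) t :=
    h.mono (fun x hx => le_trans (Set.mem_Ici.1 ht) (le_of_lt hx))
  rw [hasDerivWithinAt_iff_tendsto_slope' (by simp)] at h2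
  refine hG.mem_of_tendsto h2 ?_
  filter_upwards [self_mem_nhdsWithin] with x hx
  rw [slope_def_module]
  exact G.smul_mem _ (G.sub_mem (hF x (le_trans (Set.mem_Ici.1 ht) (le_of_lt hx))) (hF t ht))

theorem aux_const {E : Type*} [NormedAddCommGroup E] [NormedSpace ℝ E] (F : ℝ → E)
    (h : ∀ t ∈ Set.Ici (0 : ℝ), HasDerivWithinAt F 0 (Set.Ici 0) t) (t : ℝ)
    (ht : t ∈ Set.Ici (0 : ℝ)) : F t = F 0 := by
  refine constant_of_has_deriv_right_zero (a := 0) (b := t) (f := F) ?_ ?_ t ⟨ht, le_rfl⟩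
  · intro x hx
    exact ((h x hx.1).continuousWithinAt).mono (fun y hy => hy.1)
  · intro x hx
    exact (h x hx.1).mono (fun y hy => le_trans hx.1 hy)

theorem aux_prim_mem {E : Type*} [NormedAddCommGroup E] [NormedSpace ℝ E] (G : Submodule ℝ E)
    (hG : IsClosed (G : Set E)) (F F' : ℝ → E) (h0 : F 0 ∈ G)
    (hF' : ∀ s ∈ Set.Ici (0 : ℝ), F' s ∈ G)
    (h : ∀ t ∈ Set.Ici (0 : ℝ), HasDerivWithinAt F (F' t) (Set.Ici 0) t)
    (t : ℝ) (ht : t ∈ Set.Ici (0 : ℝ)) : F t ∈ G := by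
  haveI : IsClosed (G : Set E) := hG
  have key := aux_const (fun s => G.mkQL (F s)) (fun s hs => by
    have h1 := (G.mkQL.hasFDerivAt (x := F s)).comp_hasDerivWithinAt s (h s hs)
    have h2 : G.mkQL (F' s) = 0 := (Submodule.Quotient.mk_eq_zero G).2 (hF' s hs)
    rw [h2] at h1
    exact h1) t ht
  have h3 : G.mkQL (F 0) = 0 := (Submodule.Quotient.mk_eq_zero G).2 h0
  exact (Submodule.Quotient.mk_eq_zero G).1 (key.trans h3)

theorem aux_exists_prim {E : Type*} [NormedAddCommGroup E] [NormedSpace ℝ E] [CompleteSpace E]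
    (g : ℝ → E) (hg : ContinuousOn g (Set.Ici 0)) (c : E) :
    ∃ P : ℝ → E, P 0 = c ∧ ∀ t ∈ Set.Ici (0 : ℝ), HasDerivWithinAt P (g t) (Set.Ici 0) t := by
  have hc : Continuous (fun s : ℝ => g (max s 0)) :=
    hg.comp_continuous (by fun_prop) (fun x => le_max_right x 0)
  refine ⟨fun t => c + ∫ s in (0 : ℝ)..t, g (max s 0), by simp, fun t ht => ?_⟩
  have h := (hc.integral_hasStrictDerivAt 0 t).hasDerivAt.hasDerivWithinAt (s := Set.Ici 0)
  rw [max_eq_left (Set.mem_Ici.1 ht)] at h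
  exact h.const_add c

/-- Lemma 5.7. Let `L` be a self-adjoint nonnegative operator in `H`
(playing the role of `|A|`, so `A*A = L²`), `R` densely defined closable with
`dom(R) ⊇ dom(L)`, and `B` a closed operator commuting with `L` in the sense `B L ⊆ L B`.
Let `u : [0,∞) → H` be twice continuously differentiable (with `u̇ = v`, `ü = w`) such that
`u(t) ∈ dom(L²)`, `L²u(t) ∈ dom(B)`, `Lu(t) ∈ dom(B)`, `u̇(t) ∈ dom(R) ∩ dom(B)`,
`Ru̇(t) ∈ dom(B)` for `t ≥ 0`, satisfying `ü + Ru̇ + L²u = 0` on `[0,∞)`, and such that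
`t ↦ B L u(t)` and `t ↦ B u̇(t)` are continuously differentiable on `[0,∞)`.  Then
`d/dt [‖Bu̇(t)‖² + ‖L B u(t)‖²] = −2 Re⟪Bu̇(t), B R u̇(t)⟫` for `t ≥ 0` (note
`L B u = B L u` by the commutation assumption).  In particular, if `R = 0` then
`‖Bu̇(t)‖² + ‖L B u(t)‖²` is constant. -/
theorem conserved_quantities_damped_wave
    {H : Type*}
    [NormedAddCommGroup H] [InnerProductSpace ℂ H] [CompleteSpace H]
    [TopologicalSpace.SeparableSpace H]
    (L : H →ₗ.[ℂ] H)
    (hLdense : Dense (L.domain : Set H))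
    (hLsa : L.adjoint = L)
    (hLnonneg : ∀ f : L.domain, 0 ≤ (⟪(f : H), L f⟫_ℂ).re)
    (R : H →ₗ.[ℂ] H)
    (hRdense : Dense (R.domain : Set H))
    (hRclosable : R.IsClosable)
    (hRdom : L.domain ≤ R.domain)
    (Bop : H →ₗ.[ℂ] H)
    (hBclosed : Bop.IsClosed)
    -- `B L ⊆ L B`:
    (hcomm : ∀ x y z : H, (x, y) ∈ L.graph → (y, z) ∈ Bop.graph →
      ∃ w : H, (x, w) ∈ Bop.graph ∧ (w, z) ∈ L.graph)
    -- the solution `u` with `u̇ = v`, `ü = w`, and the relevant operator images: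
    (u v w Lu L2u BLu BL2u Bv Rv BRv DBLu DBv : ℝ → H)
    (hu' : ∀ t ∈ Set.Ici (0 : ℝ), HasDerivWithinAt u (v t) (Set.Ici 0) t)
    (hv' : ∀ t ∈ Set.Ici (0 : ℝ), HasDerivWithinAt v (w t) (Set.Ici 0) t)
    (hwcont : ContinuousOn w (Set.Ici 0))
    (hLu : ∀ t ∈ Set.Ici (0 : ℝ), (u t, Lu t) ∈ L.graph)
    (hL2u : ∀ t ∈ Set.Ici (0 : ℝ), (Lu t, L2u t) ∈ L.graph)
    (hBLu : ∀ t ∈ Set.Ici (0 : ℝ), (Lu t, BLu t) ∈ Bop.graph)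
    (hBL2u : ∀ t ∈ Set.Ici (0 : ℝ), (L2u t, BL2u t) ∈ Bop.graph)
    (hRv : ∀ t ∈ Set.Ici (0 : ℝ), (v t, Rv t) ∈ R.graph)
    (hBv : ∀ t ∈ Set.Ici (0 : ℝ), (v t, Bv t) ∈ Bop.graph)
    (hBRv : ∀ t ∈ Set.Ici (0 : ℝ), (Rv t, BRv t) ∈ Bop.graph)
    -- the damped abstract wave equation `ü + Ru̇ + L²u = 0`:
    (hwave : ∀ t ∈ Set.Ici (0 : ℝ), w t + Rv t + L2u t = 0)
    -- `t ↦ B L u(t)` and `t ↦ B u̇(t)` are continuously differentiable on `[0,∞)`: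
    (hBLu' : ∀ t ∈ Set.Ici (0 : ℝ), HasDerivWithinAt BLu (DBLu t) (Set.Ici 0) t)
    (hDBLucont : ContinuousOn DBLu (Set.Ici 0))
    (hBv' : ∀ t ∈ Set.Ici (0 : ℝ), HasDerivWithinAt Bv (DBv t) (Set.Ici 0) t)
    (hDBvcont : ContinuousOn DBv (Set.Ici 0)) :
    -- `d/dt [‖Bu̇‖² + ‖(LB)u‖²] = −2 Re⟪Bu̇, BRu̇⟫` (with `L B u = B L u`):
    (∀ t ∈ Set.Ici (0 : ℝ),
      HasDerivWithinAt (fun s => ‖Bv s‖ ^ 2 + ‖BLu s‖ ^ 2)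
        (-2 * (⟪Bv t, BRv t⟫_ℂ).re) (Set.Ici 0) t) ∧
    -- in particular, in the absence of damping the quantity is conserved:
    ((∀ t ∈ Set.Ici (0 : ℝ), Rv t = 0) →
      ∀ s ∈ Set.Ici (0 : ℝ), ∀ t ∈ Set.Ici (0 : ℝ),
        ‖Bv s‖ ^ 2 + ‖BLu s‖ ^ 2 = ‖Bv t‖ ^ 2 + ‖BLu t‖ ^ 2) := by
  have hLclosed : L.IsClosed := by
    have h := LinearPMap.adjoint_isClosed hLdense
    rwa [hLsa] at h
  have hsym : ∀ x y x' y' : H, (x, y) ∈ L.graph → (x', y') ∈ L.graph → ⟪y, x'⟫_ℂ = ⟪x, y'⟫_ℂ := by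
    intro x y x' y' h h'
    have hf := LinearPMap.adjoint_isFormalAdjoint hLdense
    rw [hLsa] at hf
    rw [LinearPMap.mem_graph_iff] at h h'
    obtain ⟨a, ha, ha'⟩ := h
    obtain ⟨b, hb, hb'⟩ := h'
    have := hf a b
    simp only at ha ha' hb hb'
    rwa [ha, ha', hb, hb'] at this
  have key : ∀ t ∈ Set.Ici (0 : ℝ),
      HasDerivWithinAt (fun s => ‖Bv s‖ ^ 2 + ‖BLu s‖ ^ 2)
        (-2 * (⟪Bv t, BRv t⟫_ℂ).re) (Set.Ici 0) t := by
    -- B u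
    have h0 : (0 : ℝ) ∈ Set.Ici (0 : ℝ) := Set.mem_Ici.2 le_rfl
    obtain ⟨c, hc, -⟩ := hcomm _ _ _ (hLu 0 h0) (hBLu 0 h0)
    obtain ⟨P, hP0, hP⟩ := aux_exists_prim Bv (fun t ht => (hBv' t ht).continuousWithinAt) c
    have hPB : ∀ t ∈ Set.Ici (0 : ℝ), (u t, P t) ∈ Bop.graph := fun t ht =>
      aux_prim_mem (Bop.graph.restrictScalars ℝ) hBclosed (fun s => (u s, P s))
        (fun s => (v s, Bv s)) (by simpa [hP0] using hc) hBv
        (fun s hs => (hu' s hs).prodMk (hP s hs)) t ht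
    have hPL : ∀ t ∈ Set.Ici (0 : ℝ), (P t, BLu t) ∈ L.graph := by
      intro t ht
      obtain ⟨d, hd, hd'⟩ := hcomm _ _ _ (hLu t ht) (hBLu t ht)
      rwa [Bop.mem_graph_snd_inj hd (hPB t ht) rfl] at hd'
    intro t ht
    have hLBv : (Bv t, DBLu t) ∈ L.graph :=
      aux_deriv_mem (L.graph.restrictScalars ℝ) hLclosed (fun s => (P s, BLu s)) _ t ht hPL
        ((hP t ht).prodMk (hBLu' t ht))
    have hBw : (w t, DBv t) ∈ Bop.graph :=
      aux_deriv_mem (Bop.graph.restrictScalars ℝ) hBclosed (fun s => (v s, Bv s)) _ t ht hBv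
        ((hv' t ht).prodMk (hBv' t ht))
    have hLBL : (BLu t, BL2u t) ∈ L.graph := by
      obtain ⟨d, hd, hd'⟩ := hcomm _ _ _ (hL2u t ht) (hBL2u t ht)
      rwa [Bop.mem_graph_snd_inj hd (hBLu t ht) rfl] at hd'
    have hDBv : DBv t + BRv t + BL2u t = 0 := by
      have h1 := Bop.graph.add_mem (Bop.graph.add_mem hBw (hBRv t ht)) (hBL2u t ht)
      have h2 : ((0 : H), (0 : H)) ∈ Bop.graph := Bop.graph.zero_mem
      exact Bop.mem_graph_snd_inj h1 h2 (hwave t ht)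
    have hDBv' : DBv t = -BRv t - BL2u t := by
      rw [← sub_eq_zero, ← hDBv]; abel
    have hs := hsym _ _ _ _ hLBv hLBL
    letI : InnerProductSpace ℝ H := InnerProductSpace.rclikeToReal ℂ H
    have hd := (hBv' t ht).norm_sq.add (hBLu' t ht).norm_sq
    refine hd.congr_deriv ?_
    have e : ∀ x y : H, ⟪x, y⟫_ℝ = (⟪x, y⟫_ℂ).re := fun x y => rfl
    rw [e, e, hDBv', inner_sub_right, inner_neg_right, ← hs]
    have hre : (⟪BLu t, DBLu t⟫_ℂ).re = (⟪DBLu t, BLu t⟫_ℂ).re := by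
      rw [← inner_conj_symm, Complex.conj_re]
    rw [hre, Complex.sub_re, Complex.neg_re]
    ring
  refine ⟨key, fun hR0 s hs t ht => ?_⟩
  have hz : ∀ t ∈ Set.Ici (0 : ℝ),
      HasDerivWithinAt (fun s => ‖Bv s‖ ^ 2 + ‖BLu s‖ ^ 2) 0 (Set.Ici 0) t := by
    intro t ht
    have h2 : ((0 : H), (0 : H)) ∈ Bop.graph := Bop.graph.zero_mem
    have h3 : BRv t = 0 := Bop.mem_graph_snd_inj (hBRv t ht) h2 (hR0 t ht)
    simpa [h3] using key t ht
  exact (aux_const _ hz s hs).trans (aux_const _ hz t ht).symm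
end
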